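/- There exist a constant C > 0 and a valid online rotation strategy σ such that for every nonempty finite stream L consisting of n pieces in which every piece has both edge lengths at least 1, ALG_σ(L) ≤ C·min(√n, OPT(L)^{1/4})·OPT(L), where the cost is the area of the bounding box. (A single online algorithm that is simultaneously O(√n)-competitive and O(OPT^{1/4})-competitive for area minimization with rotations allowed, when all edges are long.) -/

import Mathlib

open Set

/-- A piece is a pair (w,h) of (intended positive) real numbers. -/
abbrev Piece := ℝ × ℝ

/-- Both edge lengths of the piece are positive. -/
def PiecePos (p : Piece) : Prop := 0 < p.1 ∧ 0 < p.2

/-- The axis-parallel closed rectangle obtained by placing piece `p` by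
translation at the point `q`. -/
def placedRect (p : Piece) (q : ℝ × ℝ) : Set (ℝ × ℝ) :=
  Set.Icc q.1 (q.1 + p.1) ×ˢ Set.Icc q.2 (q.2 + p.2)

/-- Width of the axis-parallel bounding box of a set in the plane. -/
noncomputable def boxWidth (S : Set (ℝ × ℝ)) : ℝ :=
  sSup (Prod.fst '' S) - sInf (Prod.fst '' S)

/-- Height of the axis-parallel bounding box of a set in the plane. -/
noncomputable def boxHeight (S : Set (ℝ × ℝ)) : ℝ :=
  sSup (Prod.snd '' S) - sInf (Prod.snd '' S)

/-! ### Translations only -/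

/-- `pos` is a packing (by translations) of the list `L` of pieces:
the placed rectangles have pairwise disjoint interiors. -/
def IsPacking (L : List Piece) (pos : Fin L.length → ℝ × ℝ) : Prop :=
  ∀ i j : Fin L.length, i ≠ j →
    Disjoint (interior (placedRect (L.get i) (pos i)))
             (interior (placedRect (L.get j) (pos j)))

/-- The union of the placed rectangles. -/
def packedSet (L : List Piece) (pos : Fin L.length → ℝ × ℝ) : Set (ℝ × ℝ) :=
  ⋃ i : Fin L.length, placedRect (L.get i) (pos i)

/-- Perimeter of the bounding box of a packing. -/
noncomputable def periCost (L : List Piece) (pos : Fin L.length → ℝ × ℝ) : ℝ :=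
  2 * (boxWidth (packedSet L pos) + boxHeight (packedSet L pos))

/-- Area of the bounding box of a packing. -/
noncomputable def areaCost (L : List Piece) (pos : Fin L.length → ℝ × ℝ) : ℝ :=
  boxWidth (packedSet L pos) * boxHeight (packedSet L pos)

/-- Optimal offline bounding-box perimeter for the pieces of `L`. -/
noncomputable def optPeri (L : List Piece) : ℝ :=
  sInf { c | ∃ pos : Fin L.length → ℝ × ℝ, IsPacking L pos ∧ periCost L pos = c }

/-- Optimal offline bounding-box area for the pieces of `L`. -/
noncomputable def optArea (L : List Piece) : ℝ :=
  sInf { c | ∃ pos : Fin L.length → ℝ × ℝ, IsPacking L pos ∧ areaCost L pos = c }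

/-- The positions chosen by the online strategy `σ` on the stream `L`:
the `i`-th piece is placed at the point chosen by `σ` as a function of the
first `i+1` pieces. -/
def onlinePos (σ : List Piece → ℝ × ℝ) (L : List Piece) :
    Fin L.length → ℝ × ℝ :=
  fun i => σ (L.take ((i : ℕ) + 1))

/-- `σ` is a valid online translation strategy: on every stream of pieces it
produces a packing. -/
def StrategyValid (σ : List Piece → ℝ × ℝ) : Prop :=
  ∀ L : List Piece, (∀ p ∈ L, PiecePos p) → IsPacking L (onlinePos σ L)

/-- Perimeter of the bounding box of the packing produced by `σ` on `L`. -/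
noncomputable def algPeri (σ : List Piece → ℝ × ℝ) (L : List Piece) : ℝ :=
  periCost L (onlinePos σ L)

/-- Area of the bounding box of the packing produced by `σ` on `L`. -/
noncomputable def algArea (σ : List Piece → ℝ × ℝ) (L : List Piece) : ℝ :=
  areaCost L (onlinePos σ L)

/-! ### Rotations by 90° allowed -/

/-- The piece `p` in the orientation given by `r`: rotated by 90° if `r` is
`true`. -/
def orient (p : Piece) (r : Bool) : Piece := if r then (p.2, p.1) else p

/-- `pos, rot` is a packing with rotations of the list `L` of pieces. -/
def IsRotPacking (L : List Piece) (pos : Fin L.length → ℝ × ℝ)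
    (rot : Fin L.length → Bool) : Prop :=
  ∀ i j : Fin L.length, i ≠ j →
    Disjoint (interior (placedRect (orient (L.get i) (rot i)) (pos i)))
             (interior (placedRect (orient (L.get j) (rot j)) (pos j)))

/-- The union of the placed (possibly rotated) rectangles. -/
def packedRotSet (L : List Piece) (pos : Fin L.length → ℝ × ℝ)
    (rot : Fin L.length → Bool) : Set (ℝ × ℝ) :=
  ⋃ i : Fin L.length, placedRect (orient (L.get i) (rot i)) (pos i)

/-- Perimeter of the bounding box of a packing with rotations. -/
noncomputable def periRotCost (L : List Piece) (pos : Fin L.length → ℝ × ℝ)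
    (rot : Fin L.length → Bool) : ℝ :=
  2 * (boxWidth (packedRotSet L pos rot) + boxHeight (packedRotSet L pos rot))

/-- Area of the bounding box of a packing with rotations. -/
noncomputable def areaRotCost (L : List Piece) (pos : Fin L.length → ℝ × ℝ)
    (rot : Fin L.length → Bool) : ℝ :=
  boxWidth (packedRotSet L pos rot) * boxHeight (packedRotSet L pos rot)

/-- Optimal offline bounding-box perimeter with rotations allowed. -/
noncomputable def optRotPeri (L : List Piece) : ℝ :=
  sInf { c | ∃ (pos : Fin L.length → ℝ × ℝ) (rot : Fin L.length → Bool),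
    IsRotPacking L pos rot ∧ periRotCost L pos rot = c }

/-- Optimal offline bounding-box area with rotations allowed. -/
noncomputable def optRotArea (L : List Piece) : ℝ :=
  sInf { c | ∃ (pos : Fin L.length → ℝ × ℝ) (rot : Fin L.length → Bool),
    IsRotPacking L pos rot ∧ areaRotCost L pos rot = c }

/-- The positions chosen by the online rotation strategy `σ` on the stream `L`. -/
def onlineRotPos (σ : List Piece → (ℝ × ℝ) × Bool) (L : List Piece) :
    Fin L.length → ℝ × ℝ :=
  fun i => (σ (L.take ((i : ℕ) + 1))).1

/-- The orientations chosen by the online rotation strategy `σ` on the stream `L`. -/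
def onlineRot (σ : List Piece → (ℝ × ℝ) × Bool) (L : List Piece) :
    Fin L.length → Bool :=
  fun i => (σ (L.take ((i : ℕ) + 1))).2

/-- `σ` is a valid online rotation strategy: on every stream of pieces it
produces a packing with rotations. -/
def RotStrategyValid (σ : List Piece → (ℝ × ℝ) × Bool) : Prop :=
  ∀ L : List Piece, (∀ p ∈ L, PiecePos p) →
    IsRotPacking L (onlineRotPos σ L) (onlineRot σ L)

/-- Perimeter of the bounding box of the packing produced by `σ` on `L`. -/
noncomputable def algRotPeri (σ : List Piece → (ℝ × ℝ) × Bool) (L : List Piece) : ℝ :=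
  periRotCost L (onlineRotPos σ L) (onlineRot σ L)

/-- Area of the bounding box of the packing produced by `σ` on `L`. -/
noncomputable def algRotArea (σ : List Piece → (ℝ × ℝ) × Bool) (L : List Piece) : ℝ :=
  areaRotCost L (onlineRotPos σ L) (onlineRot σ L)

/-! ### Square pieces, bounding-square cost -/

/-- The axis-parallel closed square of side `s` placed at the point `q`. -/
def placedSq (s : ℝ) (q : ℝ × ℝ) : Set (ℝ × ℝ) :=
  Set.Icc q.1 (q.1 + s) ×ˢ Set.Icc q.2 (q.2 + s)

/-- `pos` is a packing of the list `L` of square pieces. -/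
def IsSqPacking (L : List ℝ) (pos : Fin L.length → ℝ × ℝ) : Prop :=
  ∀ i j : Fin L.length, i ≠ j →
    Disjoint (interior (placedSq (L.get i) (pos i)))
             (interior (placedSq (L.get j) (pos j)))

/-- The union of the placed squares. -/
def packedSqSet (L : List ℝ) (pos : Fin L.length → ℝ × ℝ) : Set (ℝ × ℝ) :=
  ⋃ i : Fin L.length, placedSq (L.get i) (pos i)

/-- Area of the smallest axis-parallel square containing all placed squares. -/
noncomputable def sqCost (L : List ℝ) (pos : Fin L.length → ℝ × ℝ) : ℝ :=
  (max (boxWidth (packedSqSet L pos)) (boxHeight (packedSqSet L pos))) ^ 2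

/-- Optimal offline bounding-square area for the square pieces of `L`. -/
noncomputable def optSq (L : List ℝ) : ℝ :=
  sInf { c | ∃ pos : Fin L.length → ℝ × ℝ, IsSqPacking L pos ∧ sqCost L pos = c }

/-- The positions chosen by the online strategy `σ` on the stream `L` of
square pieces. -/
def onlineSqPos (σ : List ℝ → ℝ × ℝ) (L : List ℝ) : Fin L.length → ℝ × ℝ :=
  fun i => σ (L.take ((i : ℕ) + 1))

/-- `σ` is a valid online translation strategy for square pieces. -/
def SqStrategyValid (σ : List ℝ → ℝ × ℝ) : Prop :=
  ∀ L : List ℝ, (∀ s ∈ L, 0 < s) → IsSqPacking L (onlineSqPos σ L)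

/-- Bounding-square area of the packing produced by `σ` on `L`. -/
noncomputable def algSq (σ : List ℝ → ℝ × ℝ) (L : List ℝ) : ℝ :=
  sqCost L (onlineSqPos σ L)

/-! ### The shelf strategy

A history is a list of pieces with the newest piece first. Pieces are turned so that their long edge
is horizontal and put on shelves whose heights are powers of four; a shelf may be filled up to the
current capacity, which grows with the history. -/

/-- The longer edge of a piece. -/
noncomputable def longEdge (p : Piece) : ℝ := max p.1 p.2

/-- The shorter edge of a piece. -/
noncomputable def shortEdge (p : Piece) : ℝ := min p.1 p.2

/-- Whether a piece has to be rotated to make its long edge horizontal. -/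
noncomputable def turn (p : Piece) : Bool := decide (p.1 < p.2)

/-- The height class of a piece: it goes on shelves of height `4 ^ (pieceClass p + 1)`. -/
noncomputable def pieceClass (p : Piece) : ℕ := Nat.log 4 ⌊shortEdge p⌋₊

/-- The total area of a history. -/
noncomputable def totalArea (r : List Piece) : ℝ := (r.map fun p => longEdge p * shortEdge p).sum

/-- The longest edge in a history. -/
noncomputable def maxLong (r : List Piece) : ℝ := r.foldr (fun p x => max (longEdge p) x) 0

/-- The longest among the short edges in a history. -/
noncomputable def maxShort (r : List Piece) : ℝ := r.foldr (fun p x => max (shortEdge p) x) 0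

/-- The total length of the long edges of the pieces of class `j`. -/
noncomputable def classLength (j : ℕ) (r : List Piece) : ℝ :=
  (r.map fun p => if pieceClass p = j then longEdge p else 0).sum

/-- The competitive ratio aimed at, with the total area in place of the optimum. -/
noncomputable def ratio (r : List Piece) : ℝ :=
  min (√(r.length : ℝ)) (√√(totalArea r))

/-- The capacity suggested by a history, regardless of earlier capacities. -/
noncomputable def targetWidth (r : List Piece) : ℝ :=
  max (2 * maxLong r)
    (min (totalArea r / maxShort r) (ratio r * max (maxLong r) √(totalArea r)))

/-- The capacity of the shelves: the running maximum of `targetWidth`. -/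
noncomputable def capacity : List Piece → ℝ
  | [] => 0
  | p :: r => max (capacity r) (targetWidth (p :: r))

/-- A stack of shelves, numbered from the bottom, with their classes and used lengths. -/
structure Shelves where
  count : ℕ
  cls : ℕ → ℕ
  used : ℕ → ℝ

namespace Shelves

/-- The height at which shelf `i` starts. -/
noncomputable def base (S : Shelves) (i : ℕ) : ℝ := ∑ k ∈ Finset.range i, (4 : ℝ) ^ (S.cls k + 1)

open Classical in
/-- A shelf of the right class with enough room for `p`, or else a new shelf. -/
noncomputable def slot (S : Shelves) (V : ℝ) (p : Piece) : ℕ :=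
  if h : ∃ i < S.count, S.cls i = pieceClass p ∧ S.used i + longEdge p ≤ V
  then h.choose else S.count

/-- Put `p` on the shelf `S.slot V p`. -/
noncomputable def insert (S : Shelves) (V : ℝ) (p : Piece) : Shelves where
  count := max S.count (S.slot V p + 1)
  cls := Function.update S.cls (S.slot V p) (pieceClass p)
  used := Function.update S.used (S.slot V p) (S.used (S.slot V p) + longEdge p)

/-- The number of shelves of class `j`. -/
def number (S : Shelves) (j : ℕ) : ℕ := {i ∈ Finset.range S.count | S.cls i = j}.card

/-- The total used length of the shelves of class `j`. -/
noncomputable def usedLength (S : Shelves) (j : ℕ) : ℝ :=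
  ∑ i ∈ Finset.range S.count with S.cls i = j, S.used i

end Shelves

/-- The shelves after a history. -/
noncomputable def shelves : List Piece → Shelves
  | [] => ⟨0, 0, 0⟩
  | p :: r => (shelves r).insert (capacity (p :: r)) p

/-- The shelf of the newest piece of a history. -/
noncomputable def newestShelf : List Piece → ℕ
  | [] => 0
  | p :: r => (shelves r).slot (capacity (p :: r)) p

/-- The point at which the newest piece of a history is placed. -/
noncomputable def newestPoint : List Piece → ℝ × ℝ
  | [] => 0
  | p :: r => ((shelves r).used (newestShelf (p :: r)), (shelves r).base (newestShelf (p :: r)))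

/-- The strategy that puts the pieces on shelves. -/
noncomputable def shelfStrategy (L : List Piece) : (ℝ × ℝ) × Bool :=
  (newestPoint L.reverse, (L.getLast?.map turn).getD false)

/-! ### Pieces and histories -/

lemma orient_turn (p : Piece) : orient p (turn p) = (longEdge p, shortEdge p) := by
  unfold orient turn longEdge shortEdge
  rcases lt_or_ge p.1 p.2 with h | h
  · simp [h, h.le]
  · simp [h, not_lt.2 h]

lemma shortEdge_lt_pow (p : Piece) : shortEdge p < 4 ^ (pieceClass p + 1) := by
  have h := Nat.lt_pow_succ_log_self (b := 4) (by norm_num) ⌊shortEdge p⌋₊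
  exact_mod_cast (Nat.floor_lt' (by positivity)).1 h

lemma pow_pieceClass_le {p : Piece} (h : 1 ≤ shortEdge p) : 4 ^ pieceClass p ≤ shortEdge p := by
  have h1 : ⌊shortEdge p⌋₊ ≠ 0 := by
    have := (Nat.one_le_floor_iff (shortEdge p)).2 h
    omega
  have h2 : ((4 ^ pieceClass p : ℕ) : ℝ) ≤ ⌊shortEdge p⌋₊ := by
    exact_mod_cast Nat.pow_log_le_self 4 h1
  have h3 := Nat.floor_le (zero_le_one.trans h)
  push_cast at h2
  linarith

lemma shortEdge_le_longEdge (p : Piece) : shortEdge p ≤ longEdge p := min_le_max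

lemma totalArea_cons (p : Piece) (r : List Piece) :
    totalArea (p :: r) = longEdge p * shortEdge p + totalArea r := by
  simp [totalArea]

lemma classLength_cons (j : ℕ) (p : Piece) (r : List Piece) :
    classLength j (p :: r) = (if pieceClass p = j then longEdge p else 0) + classLength j r := by
  simp [classLength]

lemma maxLong_cons (p : Piece) (r : List Piece) :
    maxLong (p :: r) = max (longEdge p) (maxLong r) := rfl

lemma maxShort_cons (p : Piece) (r : List Piece) :
    maxShort (p :: r) = max (shortEdge p) (maxShort r) := rfl

lemma maxLong_nonneg (r : List Piece) : 0 ≤ maxLong r := by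
  induction r with
  | nil => simp [maxLong]
  | cons p r ih => exact ih.trans (le_max_right _ _)

lemma maxShort_nonneg (r : List Piece) : 0 ≤ maxShort r := by
  induction r with
  | nil => simp [maxShort]
  | cons p r ih => exact ih.trans (le_max_right _ _)

lemma longEdge_le_maxLong {p : Piece} {r : List Piece} (h : p ∈ r) : longEdge p ≤ maxLong r := by
  induction r with
  | nil => simp at h
  | cons q r ih =>
    rcases List.mem_cons.1 h with rfl | h
    · exact le_max_left _ _
    · exact (ih h).trans (le_max_right _ _)

lemma shortEdge_le_maxShort {p : Piece} {r : List Piece} (h : p ∈ r) :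
    shortEdge p ≤ maxShort r := by
  induction r with
  | nil => simp at h
  | cons q r ih =>
    rcases List.mem_cons.1 h with rfl | h
    · exact le_max_left _ _
    · exact (ih h).trans (le_max_right _ _)

lemma exists_longEdge_eq {r : List Piece} (h : maxLong r ≠ 0) :
    ∃ p ∈ r, longEdge p = maxLong r := by
  induction r with
  | nil => simp [maxLong] at h
  | cons q r ih =>
    rw [maxLong_cons] at h ⊢
    rcases le_total (longEdge q) (maxLong r) with h' | h'
    · rw [max_eq_right h'] at h ⊢
      obtain ⟨p, hp, e⟩ := ih h
      exact ⟨p, List.mem_cons_of_mem _ hp, e⟩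
    · exact ⟨q, by simp, (max_eq_left h').symm⟩

lemma exists_shortEdge_eq {r : List Piece} (h : maxShort r ≠ 0) :
    ∃ p ∈ r, shortEdge p = maxShort r := by
  induction r with
  | nil => simp [maxShort] at h
  | cons q r ih =>
    rw [maxShort_cons] at h ⊢
    rcases le_total (shortEdge q) (maxShort r) with h' | h'
    · rw [max_eq_right h'] at h ⊢
      obtain ⟨p, hp, e⟩ := ih h
      exact ⟨p, List.mem_cons_of_mem _ hp, e⟩
    · exact ⟨q, by simp, (max_eq_left h').symm⟩

lemma capacity_nonneg (r : List Piece) : 0 ≤ capacity r := by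
  induction r with
  | nil => exact le_rfl
  | cons p r ih => exact ih.trans (le_max_left _ _)

lemma targetWidth_le_capacity (p : Piece) (r : List Piece) :
    targetWidth (p :: r) ≤ capacity (p :: r) := le_max_right _ _

lemma two_mul_longEdge_le_capacity (p : Piece) (r : List Piece) :
    2 * longEdge p ≤ capacity (p :: r) := by
  have h1 : longEdge p ≤ maxLong (p :: r) := longEdge_le_maxLong (by simp)
  have h2 : 2 * maxLong (p :: r) ≤ targetWidth (p :: r) := le_max_left _ _
  have h3 := targetWidth_le_capacity p r
  linarith

/-! ### Validity -/

namespace Shelves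

lemma slot_le (S : Shelves) (V : ℝ) (p : Piece) : S.slot V p ≤ S.count := by
  unfold slot
  split_ifs with h
  · exact h.choose_spec.1.le
  · exact le_rfl

lemma slot_spec {S : Shelves} {V : ℝ} {p : Piece} (h : S.slot V p < S.count) :
    S.cls (S.slot V p) = pieceClass p ∧ S.used (S.slot V p) + longEdge p ≤ V := by
  unfold slot at h ⊢
  split_ifs at h ⊢ with h'
  · exact h'.choose_spec.2
  · exact absurd h (lt_irrefl _)

lemma lt_used_add {S : Shelves} {V : ℝ} {p : Piece} (h : S.slot V p = S.count) {i : ℕ}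
    (hi : i < S.count) (hc : S.cls i = pieceClass p) : V < S.used i + longEdge p := by
  by_contra! hV
  have h' : ∃ i < S.count, S.cls i = pieceClass p ∧ S.used i + longEdge p ≤ V := ⟨i, hi, hc, hV⟩
  unfold slot at h
  rw [dif_pos h'] at h
  exact h'.choose_spec.1.ne h

lemma insert_count_of_lt {S : Shelves} {V : ℝ} {p : Piece} (h : S.slot V p < S.count) :
    (S.insert V p).count = S.count := max_eq_left h

lemma insert_cls_of_lt {S : Shelves} {V : ℝ} {p : Piece} (h : S.slot V p < S.count) :
    (S.insert V p).cls = S.cls := by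
  simp only [insert]
  rw [← (slot_spec h).1, Function.update_eq_self]

lemma insert_count_of_eq {S : Shelves} {V : ℝ} {p : Piece} (h : S.slot V p = S.count) :
    (S.insert V p).count = S.count + 1 := by simp [insert, h]

lemma insert_cls {S : Shelves} {V : ℝ} {p : Piece} {i : ℕ} (hi : i < S.count) :
    (S.insert V p).cls i = S.cls i := by
  rcases (S.slot_le V p).lt_or_eq with h | h
  · rw [insert_cls_of_lt h]
  · simp [insert, h, hi.ne]

lemma insert_cls_slot (S : Shelves) (V : ℝ) (p : Piece) :
    (S.insert V p).cls (S.slot V p) = pieceClass p := by simp [insert]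

lemma count_le_insert (S : Shelves) (V : ℝ) (p : Piece) : S.count ≤ (S.insert V p).count :=
  le_max_left _ _

lemma slot_lt_insert (S : Shelves) (V : ℝ) (p : Piece) :
    S.slot V p < (S.insert V p).count := lt_of_lt_of_le (Nat.lt_succ_self _) (le_max_right _ _)

lemma insert_base {S : Shelves} {V : ℝ} {p : Piece} {i : ℕ} (hi : i ≤ S.count) :
    (S.insert V p).base i = S.base i :=
  Finset.sum_congr rfl fun k hk => by
    rw [insert_cls ((Finset.mem_range.1 hk).trans_le hi)]

lemma base_mono (S : Shelves) : Monotone S.base := fun i j h =>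
  Finset.sum_le_sum_of_subset_of_nonneg (Finset.range_mono h) fun _ _ _ => by positivity

lemma base_nonneg (S : Shelves) (i : ℕ) : 0 ≤ S.base i := Finset.sum_nonneg fun _ _ => by positivity

lemma base_succ (S : Shelves) (i : ℕ) : S.base (i + 1) = S.base i + 4 ^ (S.cls i + 1) :=
  Finset.sum_range_succ _ _

lemma used_le_insert {S : Shelves} {V : ℝ} {p : Piece} (hp : 0 ≤ longEdge p) (i : ℕ) :
    S.used i ≤ (S.insert V p).used i := by
  by_cases h : i = S.slot V p
  · subst h
    simpa [insert] using hp
  · simp [insert, h]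

end Shelves

lemma shelves_used_of_count_le (r : List Piece) {i : ℕ} (hi : (shelves r).count ≤ i) :
    (shelves r).used i = 0 := by
  induction r generalizing i with
  | nil => rfl
  | cons p r ih =>
    have h1 := (Shelves.slot_lt_insert (shelves r) (capacity (p :: r)) p).trans_le hi
    have h2 := (Shelves.count_le_insert (shelves r) (capacity (p :: r)) p).trans hi
    change Function.update (shelves r).used _ _ i = 0
    rw [Function.update_of_ne h1.ne', ih h2]

lemma shelves_used_nonneg {r : List Piece} (hr : ∀ p ∈ r, 0 ≤ longEdge p) (i : ℕ) :
    0 ≤ (shelves r).used i := by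
  induction r with
  | nil => exact le_rfl
  | cons p r ih =>
    exact (ih fun q hq => hr q (List.mem_cons_of_mem _ hq)).trans
      (Shelves.used_le_insert (hr p (by simp)) i)

lemma shelves_used_le (r : List Piece) (i : ℕ) : (shelves r).used i ≤ capacity r := by
  induction r with
  | nil => exact le_rfl
  | cons p r ih =>
    have hmono : capacity r ≤ capacity (p :: r) := le_max_left _ _
    change Function.update (shelves r).used _ _ i ≤ _
    by_cases h : i = (shelves r).slot (capacity (p :: r)) p
    · rw [h, Function.update_self]
      rcases ((shelves r).slot_le (capacity (p :: r)) p).lt_or_eq with h' | h'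
      · exact (Shelves.slot_spec h').2
      · rw [h', shelves_used_of_count_le r le_rfl]
        have := two_mul_longEdge_le_capacity p r
        have := capacity_nonneg (p :: r)
        linarith
    · rw [Function.update_of_ne h]
      exact ih.trans hmono

/-- Every piece of a history lies within the used part of its shelf. -/
lemma newest_mem_shelf {r s : List Piece} {p : Piece} (hr : ∀ q ∈ r, 0 ≤ longEdge q)
    (hs : p :: s <:+ r) :
    newestShelf (p :: s) < (shelves r).count ∧
      (shelves r).cls (newestShelf (p :: s)) = pieceClass p ∧
      (newestPoint (p :: s)).2 = (shelves r).base (newestShelf (p :: s)) ∧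
      (newestPoint (p :: s)).1 + longEdge p ≤ (shelves r).used (newestShelf (p :: s)) := by
  induction r with
  | nil => simp at hs
  | cons q r ih =>
    rcases List.suffix_cons_iff.1 hs with h | h
    · obtain ⟨rfl, rfl⟩ := List.cons.inj h
      refine ⟨Shelves.slot_lt_insert _ _ _, Shelves.insert_cls_slot _ _ _,
        (Shelves.insert_base (Shelves.slot_le _ _ _)).symm, ?_⟩
      simp [newestPoint, newestShelf, shelves, Shelves.insert]
    · obtain ⟨h1, h2, h3, h4⟩ := ih (fun a ha => hr a (List.mem_cons_of_mem _ ha)) h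
      exact ⟨h1.trans_le (Shelves.count_le_insert _ _ _), (Shelves.insert_cls h1).trans h2,
        h3.trans (Shelves.insert_base h1.le).symm,
        h4.trans (Shelves.used_le_insert (hr q (by simp)) _)⟩

lemma interior_placedRect (p : Piece) (q : ℝ × ℝ) :
    interior (placedRect p q) = Ioo q.1 (q.1 + p.1) ×ˢ Ioo q.2 (q.2 + p.2) := by
  rw [placedRect, interior_prod_eq, interior_Icc, interior_Icc]

/-- The newest piece does not overlap any earlier one. -/
lemma disjoint_newest {r s : List Piece} {p q : Piece} (hr : ∀ a ∈ r, 0 ≤ longEdge a)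
    (hs : q :: s <:+ r) :
    Disjoint (interior (placedRect (longEdge q, shortEdge q) (newestPoint (q :: s))))
      (interior (placedRect (longEdge p, shortEdge p) (newestPoint (p :: r)))) := by
  obtain ⟨h1, h2, h3, h4⟩ := newest_mem_shelf hr hs
  rw [interior_placedRect, interior_placedRect, Set.disjoint_left]
  rintro ⟨x, y⟩ ⟨⟨hx1, hx2⟩, hy1, hy2⟩ ⟨⟨hx3, hx4⟩, hy3, hy4⟩
  dsimp only at hx1 hx2 hx3 hx4 hy1 hy2 hy3 hy4
  have e1 : (newestPoint (p :: r)).1 = (shelves r).used (newestShelf (p :: r)) := rfl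
  have e2 : (newestPoint (p :: r)).2 = (shelves r).base (newestShelf (p :: r)) := rfl
  rcases lt_trichotomy (newestShelf (q :: s)) (newestShelf (p :: r)) with h | h | h
  · have := (shelves r).base_mono (Nat.succ_le_of_lt h)
    rw [Nat.succ_eq_add_one, Shelves.base_succ, h2] at this
    have := shortEdge_lt_pow q
    linarith
  · rw [h] at h4
    linarith
  · have := (shelves r).base_mono (Nat.succ_le_of_lt h)
    have hc : (shelves r).cls (newestShelf (p :: r)) = pieceClass p :=
      (Shelves.slot_spec (h.trans h1)).1
    rw [Nat.succ_eq_add_one, Shelves.base_succ, hc] at this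
    have := shortEdge_lt_pow p
    linarith

lemma shelfStrategy_take {L : List Piece} {i : ℕ} (hi : i < L.length) :
    shelfStrategy (L.take (i + 1)) =
      (newestPoint (L[i] :: (L.take i).reverse), turn L[i]) := by
  rw [shelfStrategy, ← List.take_append_getElem hi]
  simp [-List.take_append_getElem]

lemma longEdge_nonneg {p : Piece} (hp : PiecePos p) : 0 ≤ longEdge p :=
  hp.1.le.trans (le_max_left _ _)

lemma cons_reverse_take_suffix {L : List Piece} {i j : ℕ} (hi : i < L.length) (hij : i < j) :
    L[i] :: (L.take i).reverse <:+ (L.take j).reverse := by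
  have h : (L.take (i + 1)).reverse = L[i] :: (L.take i).reverse := by
    rw [← List.take_append_getElem hi]
    simp
  rw [← h, List.reverse_suffix]
  exact List.take_prefix_take_left (by omega)

lemma shelfStrategy_valid : RotStrategyValid shelfStrategy := by
  intro L hL
  have key : ∀ i j : Fin L.length, i < j →
      Disjoint (interior (placedRect (orient (L.get i) (onlineRot shelfStrategy L i))
          (onlineRotPos shelfStrategy L i)))
        (interior (placedRect (orient (L.get j) (onlineRot shelfStrategy L j))
          (onlineRotPos shelfStrategy L j))) := by
    intro i j hij
    simp only [onlineRot, onlineRotPos, shelfStrategy_take i.2, shelfStrategy_take j.2,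
      List.get_eq_getElem, orient_turn]
    exact disjoint_newest
      (fun a ha => longEdge_nonneg (hL a (List.mem_of_mem_take (List.mem_reverse.1 ha))))
      (cons_reverse_take_suffix i.2 hij)
  intro i j hij
  rcases lt_or_gt_of_ne hij with h | h
  · exact key i j h
  · exact (key j i h).symm

/-! ### The number of shelves -/

lemma Shelves.number_usedLength_insert_of_lt {S : Shelves} {V : ℝ} {p : Piece}
    (h : S.slot V p < S.count) (j : ℕ) :
    (S.insert V p).number j = S.number j ∧
      (S.insert V p).usedLength j =
        (if pieceClass p = j then longEdge p else 0) + S.usedLength j := by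
  have hc := (Shelves.slot_spec h).1
  refine ⟨by simp [number, insert_count_of_lt h, insert_cls_of_lt h], ?_⟩
  have hu : ∀ i, (S.insert V p).used i = S.used i + if i = S.slot V p then longEdge p else 0 := by
    intro i
    by_cases hi : i = S.slot V p <;> simp [insert, hi]
  simp only [usedLength, insert_count_of_lt h, insert_cls_of_lt h, hu, Finset.sum_add_distrib,
    Finset.sum_ite_eq', Finset.mem_filter, Finset.mem_range, h, hc, true_and]
  ring

lemma Shelves.number_usedLength_insert_of_eq {S : Shelves} {V : ℝ} {p : Piece}
    (h : S.slot V p = S.count) (h0 : S.used S.count = 0) (j : ℕ) :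
    (S.insert V p).number j = (if pieceClass p = j then 1 else 0) + S.number j ∧
      (S.insert V p).usedLength j =
        (if pieceClass p = j then longEdge p else 0) + S.usedLength j := by
  constructor
  · simp only [number, insert_count_of_eq h, Finset.card_filter, Finset.sum_range_succ]
    rw [add_comm]
    congr 1
    · rw [← h, insert_cls_slot]
    · exact Finset.sum_congr rfl fun i hi => by rw [insert_cls (Finset.mem_range.1 hi)]
  · simp only [usedLength, insert_count_of_eq h, Finset.sum_filter, Finset.sum_range_succ]
    rw [add_comm]
    congr 1
    · rw [← h, insert_cls_slot, h]
      simp [insert, h, h0]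
    · refine Finset.sum_congr rfl fun i hi => ?_
      have hi' := (Finset.mem_range.1 hi).ne
      rw [insert_cls (Finset.mem_range.1 hi)]
      simp [insert, h, hi']

lemma usedLength_shelves (r : List Piece) (j : ℕ) :
    (shelves r).usedLength j = classLength j r := by
  induction r with
  | nil => simp [shelves, Shelves.usedLength, classLength]
  | cons p r ih =>
    rw [classLength_cons, ← ih]
    rcases ((shelves r).slot_le (capacity (p :: r)) p).lt_or_eq with h | h
    · exact (Shelves.number_usedLength_insert_of_lt h j).2
    · exact (Shelves.number_usedLength_insert_of_eq h (shelves_used_of_count_le r le_rfl) j).2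

lemma classLength_le_cons {p : Piece} (hp : 0 ≤ longEdge p) (r : List Piece) (j : ℕ) :
    classLength j r ≤ classLength j (p :: r) := by
  rw [classLength_cons]
  split_ifs <;> linarith

lemma classLength_nonneg {r : List Piece} (hr : ∀ p ∈ r, 0 ≤ longEdge p) (j : ℕ) :
    0 ≤ classLength j r := by
  refine List.sum_nonneg fun x hx => ?_
  obtain ⟨p, hp, rfl⟩ := List.mem_map.1 hx
  split_ifs
  · exact hr p hp
  · exact le_rfl

/-- A shelf is only opened when all shelves of its class are at least half full. -/
lemma number_cons {p : Piece} {r : List Piece} (hr : ∀ q ∈ p :: r, 0 < longEdge q) (j : ℕ) :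
    (shelves (p :: r)).number j = (shelves r).number j ∨
      (4 : ℝ) ^ (j + 1) * (shelves (p :: r)).number j ≤
        4 ^ (j + 1) + 8 * (4 ^ j * classLength j (p :: r)) / capacity (p :: r) := by
  have hp := hr p (by simp)
  have hr' : ∀ q ∈ r, 0 ≤ longEdge q := fun q hq => (hr q (List.mem_cons_of_mem _ hq)).le
  rcases ((shelves r).slot_le (capacity (p :: r)) p).lt_or_eq with h | h
  · exact Or.inl (Shelves.number_usedLength_insert_of_lt h j).1
  have hn : (shelves (p :: r)).number j = _ :=
    (Shelves.number_usedLength_insert_of_eq h (shelves_used_of_count_le r le_rfl) j).1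
  by_cases hj : pieceClass p = j
  swap
  · exact Or.inl (by simpa [hj] using hn)
  right
  have hV := two_mul_longEdge_le_capacity p r
  have hV0 : 0 < capacity (p :: r) := by linarith
  have hsum : (shelves r).number j * (capacity (p :: r) / 2) ≤ classLength j r := by
    rw [← usedLength_shelves, Shelves.number, ← nsmul_eq_mul]
    refine Finset.card_nsmul_le_sum _ _ _ fun i hi => ?_
    rw [Finset.mem_filter, Finset.mem_range] at hi
    have := Shelves.lt_used_add h hi.1 (hi.2.trans hj.symm)
    linarith
  have hsum' := hsum.trans (classLength_le_cons hp.le r j)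
  rw [if_pos hj] at hn
  have h8 : (4 : ℝ) ^ (j + 1) * (shelves r).number j ≤
      8 * (4 ^ j * classLength j (p :: r)) / capacity (p :: r) := by
    rw [le_div_iff₀ hV0, pow_succ]
    have := mul_le_mul_of_nonneg_left hsum' (by positivity : (0 : ℝ) ≤ 8 * 4 ^ j)
    linarith
  rw [hn]
  push_cast
  linarith

lemma number_shelves_nil (j : ℕ) : (shelves []).number j = 0 := rfl

lemma classLength_le (r : List Piece) (j : ℕ) : classLength j r ≤ r.length * maxLong r := by
  have h : classLength j r ≤ (r.map fun p => if pieceClass p = j then longEdge p else 0).length •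
      maxLong r := by
    refine List.sum_le_card_nsmul _ _ fun x hx => ?_
    obtain ⟨p, hp, rfl⟩ := List.mem_map.1 hx
    split_ifs
    · exact longEdge_le_maxLong hp
    · exact maxLong_nonneg r
  simpa using h

lemma sum_classLength_le {r : List Piece} (hr : ∀ p ∈ r, 1 ≤ shortEdge p) (s : Finset ℕ) :
    ∑ j ∈ s, (4 : ℝ) ^ j * classLength j r ≤ totalArea r := by
  induction r with
  | nil => simp [classLength, totalArea]
  | cons p r ih =>
    have h1 := hr p (by simp)
    have h2 := ih fun q hq => hr q (List.mem_cons_of_mem _ hq)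
    have h3 := shortEdge_le_longEdge p
    have h4 := mul_le_mul_of_nonneg_right (pow_pieceClass_le h1)
      (by linarith : (0 : ℝ) ≤ longEdge p)
    have h5 : (0 : ℝ) ≤ 4 ^ pieceClass p * longEdge p := by
      have : (0 : ℝ) ≤ longEdge p := by linarith
      positivity
    simp only [totalArea_cons, classLength_cons, mul_add, Finset.sum_add_distrib, mul_ite,
      mul_zero, Finset.sum_ite_eq]
    split_ifs <;> linarith

lemma exists_mem_of_number_pos {r : List Piece} {j : ℕ} (h : 0 < (shelves r).number j) :
    ∃ p ∈ r, pieceClass p = j := by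
  induction r with
  | nil => simp [number_shelves_nil] at h
  | cons p r ih =>
    by_cases hj : pieceClass p = j
    · exact ⟨p, by simp, hj⟩
    have hn : (shelves (p :: r)).number j = (shelves r).number j := by
      rcases ((shelves r).slot_le (capacity (p :: r)) p).lt_or_eq with h' | h'
      · exact (Shelves.number_usedLength_insert_of_lt h' j).1
      · refine (Shelves.number_usedLength_insert_of_eq h'
          (shelves_used_of_count_le r le_rfl) j).1.trans ?_
        simp [hj]
    obtain ⟨q, hq, e⟩ := ih (hn ▸ h)
    exact ⟨q, List.mem_cons_of_mem _ hq, e⟩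

lemma pow_le_maxShort {r : List Piece} (hr : ∀ p ∈ r, 1 ≤ shortEdge p) {j : ℕ}
    (h : 0 < (shelves r).number j) : (4 : ℝ) ^ j ≤ maxShort r := by
  obtain ⟨p, hp, rfl⟩ := exists_mem_of_number_pos h
  exact (pow_pieceClass_le (hr p hp)).trans (shortEdge_le_maxShort hp)

/-- The total height of the shelves, class by class. -/
lemma base_count_eq (S : Shelves) {K : ℕ} (hK : ∀ j, K ≤ j → S.number j = 0) :
    S.base S.count = ∑ j ∈ Finset.range K, (4 : ℝ) ^ (j + 1) * S.number j := by
  have hm : ∀ i ∈ Finset.range S.count, S.cls i ∈ Finset.range K := by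
    intro i hi
    by_contra hc
    have h0 := hK (S.cls i) (by simpa using hc)
    rw [Shelves.number, Finset.card_eq_zero] at h0
    exact Finset.notMem_empty i (h0 ▸ Finset.mem_filter.2 ⟨hi, rfl⟩)
  rw [Shelves.base, ← Finset.sum_fiberwise_of_maps_to hm]
  refine Finset.sum_congr rfl fun j _ => ?_
  rw [Finset.sum_congr rfl (g := fun _ => (4 : ℝ) ^ (j + 1))
    fun i hi => by rw [(Finset.mem_filter.1 hi).2]]
  rw [Finset.sum_const, nsmul_eq_mul, mul_comm, Shelves.number]

/-! ### Bounds for a history with long edges -/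

section LongEdges

variable {r : List Piece}

lemma length_le_totalArea (hr : ∀ p ∈ r, 1 ≤ shortEdge p) : (r.length : ℝ) ≤ totalArea r := by
  induction r with
  | nil => simp [totalArea]
  | cons p r ih =>
    have h1 := hr p (by simp)
    have h2 := ih fun q hq => hr q (List.mem_cons_of_mem _ hq)
    have h3 := shortEdge_le_longEdge p
    rw [totalArea_cons]
    push_cast [List.length_cons]
    nlinarith

lemma totalArea_nonneg (hr : ∀ p ∈ r, 1 ≤ shortEdge p) : 0 ≤ totalArea r :=
  (Nat.cast_nonneg _).trans (length_le_totalArea hr)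

lemma area_le_totalArea (hr : ∀ p ∈ r, 1 ≤ shortEdge p) {p : Piece} (hp : p ∈ r) :
    longEdge p * shortEdge p ≤ totalArea r := by
  refine List.single_le_sum ?_ _ (List.mem_map.2 ⟨p, hp, rfl⟩)
  intro x hx
  obtain ⟨q, hq, rfl⟩ := List.mem_map.1 hx
  have := hr q hq
  have := shortEdge_le_longEdge q
  nlinarith

lemma one_le_maxShort (hr : ∀ p ∈ r, 1 ≤ shortEdge p) (h : r ≠ []) : 1 ≤ maxShort r := by
  obtain ⟨p, hp⟩ := List.exists_mem_of_ne_nil r h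
  exact (hr p hp).trans (shortEdge_le_maxShort hp)

lemma maxShort_sq_le (hr : ∀ p ∈ r, 1 ≤ shortEdge p) : maxShort r ^ 2 ≤ totalArea r := by
  by_cases h : maxShort r = 0
  · rw [h]
    simpa using totalArea_nonneg hr
  obtain ⟨p, hp, e⟩ := exists_shortEdge_eq h
  have h1 := hr p hp
  have h2 := shortEdge_le_longEdge p
  have h3 := area_le_totalArea hr hp
  rw [← e]
  nlinarith

lemma maxShort_le_maxLong (r : List Piece) : maxShort r ≤ maxLong r := by
  induction r with
  | nil => simp [maxShort, maxLong]
  | cons p r ih => exact max_le_max (shortEdge_le_longEdge p) ih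

lemma one_le_ratio (hr : ∀ p ∈ r, 1 ≤ shortEdge p) (h : r ≠ []) : 1 ≤ ratio r := by
  have h1 : (1 : ℝ) ≤ r.length := by exact_mod_cast List.length_pos_iff.2 h
  have h2 := length_le_totalArea hr
  refine le_min (Real.one_le_sqrt.2 h1) (Real.one_le_sqrt.2 (Real.one_le_sqrt.2 (h1.trans h2)))

lemma div_le_of_capacity_bounds {x y q s M W a : ℝ} (hx : 1 ≤ x) (hxy : x ≤ y) (hyq : y ≤ q)
    (hs : 1 ≤ s) (hM : 0 < M) (hW : 2 * M ≤ W)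
    (hW' : min (q ^ 4 / y ^ 2) (min s q * max M (q ^ 2)) ≤ W) (ha : 0 ≤ a)
    (ha1 : a ≤ x ^ 2 * (s ^ 2 * M)) (ha2 : a ≤ q ^ 4) : a / W ≤ x * y * min s q := by
  have hW0 : 0 < W := by linarith
  have hy : 0 < y := by linarith
  have hq : 0 < q := by linarith
  have hx0 : 0 < x := by linarith
  have hs0 : 0 < s := by linarith
  have hxy1 : 1 ≤ x * y := by nlinarith
  rw [div_le_iff₀ hW0]
  rcases min_le_iff.1 hW' with h | h
  · rw [div_le_iff₀ (by positivity)] at h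
    have hay : a ≤ W * y ^ 2 := ha2.trans h
    rcases min_cases s q with ⟨e, -⟩ | ⟨e, -⟩ <;> rw [e]
    · have has : a ≤ x ^ 2 * (s ^ 2 * W) := ha1.trans (by gcongr; linarith)
      refine le_of_sq_le_sq ?_ (by positivity)
      calc a ^ 2 = a * a := sq a
        _ ≤ (W * y ^ 2) * (x ^ 2 * (s ^ 2 * W)) := by gcongr
        _ = _ := by ring
    · calc a ≤ W * y ^ 2 := hay
        _ = 1 * y * y * W := by ring
        _ ≤ x * y * q * W := by gcongr
  · have hρ : 0 < min s q := lt_min hs0 hq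
    have h1 : min s q * M ≤ W := (by gcongr; exact le_max_left _ _ : _ ≤ _).trans h
    have h2 : min s q * q ^ 2 ≤ W := (by gcongr; exact le_max_right _ _ : _ ≤ _).trans h
    rcases min_cases s q with ⟨e, -⟩ | ⟨e, -⟩ <;> rw [e] at h1 h2 ⊢
    · calc a ≤ x * x * s * (s * M) := ha1.trans_eq (by ring)
        _ ≤ x * y * s * W := by gcongr
    · calc a ≤ 1 * q * (q * q ^ 2) := ha2.trans_eq (by ring)
        _ ≤ x * y * q * W := by gcongr

/-- The shelves of a class are not much higher than the competitive ratio allows. -/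
lemma classLength_div_le (hr : ∀ p ∈ r, 1 ≤ shortEdge p) (hne : r ≠ []) {j : ℕ}
    (hj : (4 : ℝ) ^ j ≤ maxShort r) :
    4 ^ j * classLength j r / targetWidth r ≤ 2 ^ j * √(maxShort r) * ratio r := by
  have hA := totalArea_nonneg hr
  have hm := one_le_maxShort hr hne
  have hM := maxShort_le_maxLong r
  have h4 : (4 : ℝ) ^ j = (2 ^ j) ^ 2 := by rw [← pow_mul, mul_comm, pow_mul]; norm_num
  have hq2 : √√(totalArea r) ^ 2 = √(totalArea r) := Real.sq_sqrt (Real.sqrt_nonneg _)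
  have hq4 : √√(totalArea r) ^ 4 = totalArea r := by
    rw [show 4 = 2 * 2 from rfl, pow_mul, hq2, Real.sq_sqrt hA]
  have hlen : (1 : ℝ) ≤ r.length := by exact_mod_cast List.length_pos_iff.2 hne
  have hle : ∀ p ∈ r, 0 ≤ longEdge p := fun p hp =>
    (zero_le_one.trans (hr p hp)).trans (shortEdge_le_longEdge p)
  refine div_le_of_capacity_bounds (M := maxLong r) (one_le_pow₀ one_le_two) ?_ ?_
    (Real.one_le_sqrt.2 hlen) (by linarith) (le_max_left _ _) ?_ ?_ ?_ ?_
  · exact Real.le_sqrt_of_sq_le (h4 ▸ hj)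
  · exact Real.sqrt_le_sqrt (Real.le_sqrt_of_sq_le (maxShort_sq_le hr))
  · rw [hq4, hq2, Real.sq_sqrt (by linarith)]
    exact le_max_right _ _
  · exact mul_nonneg (by positivity) (classLength_nonneg hle j)
  · rw [← h4, Real.sq_sqrt (by linarith)]
    gcongr
    exact classLength_le r j
  · rw [hq4]
    simpa using sum_classLength_le hr {j}

lemma maxLong_pos (hr : ∀ p ∈ r, 1 ≤ shortEdge p) (h : r ≠ []) : 0 < maxLong r := by
  have := one_le_maxShort hr h
  have := maxShort_le_maxLong r
  linarith

lemma targetWidth_pos (hr : ∀ p ∈ r, 1 ≤ shortEdge p) (h : r ≠ []) : 0 < targetWidth r :=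
  lt_of_lt_of_le (by linarith [maxLong_pos hr h]) (le_max_left (2 * maxLong r) _)

lemma totalArea_mono {s : List Piece} (hr : ∀ p ∈ r, 1 ≤ shortEdge p) (hs : s <:+ r) :
    totalArea s ≤ totalArea r := by
  obtain ⟨t, rfl⟩ := hs
  have : totalArea (t ++ s) = totalArea t + totalArea s := by simp [totalArea]
  rw [this]
  linarith [totalArea_nonneg (r := t) fun p hp => hr p (List.mem_append_left _ hp)]

lemma ratio_mono {s : List Piece} (hr : ∀ p ∈ r, 1 ≤ shortEdge p) (hs : s <:+ r) :
    ratio s ≤ ratio r := by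
  have hA := totalArea_mono hr hs
  have hl : (s.length : ℝ) ≤ r.length := by exact_mod_cast hs.length_le
  exact min_le_min (Real.sqrt_le_sqrt hl) (Real.sqrt_le_sqrt (Real.sqrt_le_sqrt hA))

lemma number_le (hr : ∀ p ∈ r, 1 ≤ shortEdge p) (j : ℕ) (hj : 0 < (shelves r).number j) :
    (4 : ℝ) ^ (j + 1) * (shelves r).number j ≤ 12 * (2 ^ j * √(maxShort r) * ratio r) := by
  induction r with
  | nil => simp [number_shelves_nil] at hj
  | cons p r ih =>
    have hr' : ∀ q ∈ r, 1 ≤ shortEdge q := fun q hq => hr q (List.mem_cons_of_mem _ hq)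
    have hpos : ∀ q ∈ p :: r, 0 < longEdge q := fun q hq =>
      (zero_lt_one.trans_le (hr q hq)).trans_le (shortEdge_le_longEdge q)
    have hm4 := pow_le_maxShort hr hj
    rcases number_cons hpos j with h | h
    · rw [h] at hj ⊢
      refine (ih hr' hj).trans ?_
      have h1 : maxShort r ≤ maxShort (p :: r) := le_max_right _ _
      have h2 := ratio_mono hr (List.suffix_cons p r)
      have h3 : 0 ≤ ratio r := le_min (Real.sqrt_nonneg _) (Real.sqrt_nonneg _)
      gcongr
    · refine h.trans ?_
      have h1 := classLength_div_le hr (by simp) hm4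
      have h2 : 8 * (4 ^ j * classLength j (p :: r)) / capacity (p :: r) ≤
          8 * (4 ^ j * classLength j (p :: r) / targetWidth (p :: r)) := by
        rw [mul_div_assoc]
        have := classLength_nonneg (fun q hq => (hpos q hq).le) j
        have := targetWidth_pos hr (by simp)
        have := targetWidth_le_capacity p r
        gcongr
      have h3 : (4 : ℝ) ^ (j + 1) = 4 * (2 ^ j * 2 ^ j * 1) := by
        rw [pow_succ, ← mul_pow]
        norm_num
        ring
      have h4 : (2 : ℝ) ^ j ≤ √(maxShort (p :: r)) := by
        refine Real.le_sqrt_of_sq_le ?_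
        rw [← pow_mul, mul_comm, pow_mul]
        norm_num
        exact hm4
      have h5 := one_le_ratio hr (by simp)
      have h6 : (2 : ℝ) ^ j * 2 ^ j * 1 ≤ 2 ^ j * √(maxShort (p :: r)) * ratio (p :: r) := by
        gcongr
      linarith

lemma exists_class_bound (hr : ∀ p ∈ r, 1 ≤ shortEdge p) (hne : r ≠ []) :
    ∃ K, (∀ j, K ≤ j → (shelves r).number j = 0) ∧ (4 : ℝ) ^ K ≤ 4 * maxShort r := by
  have hm := one_le_maxShort hr hne
  refine ⟨Nat.log 4 ⌊maxShort r⌋₊ + 1, fun j hj => ?_, ?_⟩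
  · by_contra h
    have h1 := pow_le_maxShort hr (Nat.pos_of_ne_zero h)
    have h2 : 4 ^ j ≤ ⌊maxShort r⌋₊ := Nat.le_floor (by exact_mod_cast h1)
    have h3 := Nat.le_log_of_pow_le (by norm_num) h2
    omega
  · have h1 : ⌊maxShort r⌋₊ ≠ 0 := by
      have := (Nat.one_le_floor_iff (maxShort r)).2 hm
      omega
    have h2 : ((4 ^ Nat.log 4 ⌊maxShort r⌋₊ : ℕ) : ℝ) ≤ ⌊maxShort r⌋₊ := by
      exact_mod_cast Nat.pow_log_le_self 4 h1
    have h3 := Nat.floor_le (zero_le_one.trans hm)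
    push_cast at h2
    rw [pow_succ]
    linarith

lemma height_le (hr : ∀ p ∈ r, 1 ≤ shortEdge p) (hne : r ≠ []) :
    (shelves r).base (shelves r).count ≤ 24 * (maxShort r * ratio r) := by
  obtain ⟨K, hK, hK4⟩ := exists_class_bound hr hne
  have hm := one_le_maxShort hr hne
  have hρ := one_le_ratio hr hne
  rw [base_count_eq _ hK]
  have h1 : ∑ j ∈ Finset.range K, (4 : ℝ) ^ (j + 1) * (shelves r).number j ≤
      ∑ j ∈ Finset.range K, 2 ^ j * (12 * √(maxShort r) * ratio r) := by
    refine Finset.sum_le_sum fun j _ => ?_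
    rcases Nat.eq_zero_or_pos ((shelves r).number j) with h | h
    · rw [h]
      have : 0 ≤ ratio r := by linarith
      simp only [Nat.cast_zero, mul_zero]
      positivity
    · refine (number_le hr j h).trans_eq (by ring)
  have h2 : ∑ j ∈ Finset.range K, (2 : ℝ) ^ j ≤ 2 * √(maxShort r) := by
    rw [geom_sum_eq (by norm_num)]
    have h3 : (2 : ℝ) ^ K ≤ 2 * √(maxShort r) := by
      refine le_of_sq_le_sq ?_ (by positivity)
      rw [mul_pow, Real.sq_sqrt (by linarith), ← pow_mul, mul_comm K, pow_mul]
      norm_num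
      exact hK4
    linarith
  refine h1.trans ?_
  rw [← Finset.sum_mul]
  calc _ ≤ 2 * √(maxShort r) * (12 * √(maxShort r) * ratio r) := by
        have : 0 ≤ ratio r := by linarith
        gcongr
    _ = 24 * (√(maxShort r) ^ 2 * ratio r) := by ring
    _ = _ := by rw [Real.sq_sqrt (by linarith)]

lemma targetWidth_le_capacity_of_suffix {s : List Piece} (hs : s <:+ r) (hne : s ≠ []) :
    targetWidth s ≤ capacity r := by
  induction r with
  | nil => exact absurd (List.suffix_nil.1 hs) hne
  | cons p r ih =>
    rcases List.suffix_cons_iff.1 hs with rfl | h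
    · exact le_max_right _ _
    · exact (ih h).trans (le_max_left _ _)

lemma exists_targetWidth_eq_capacity (hr : ∀ p ∈ r, 1 ≤ shortEdge p) (hne : r ≠ []) :
    ∃ s, s <:+ r ∧ s ≠ [] ∧ capacity r = targetWidth s := by
  induction r with
  | nil => exact absurd rfl hne
  | cons p r ih =>
    rcases le_total (capacity r) (targetWidth (p :: r)) with h | h
    · exact ⟨p :: r, List.suffix_rfl, by simp, max_eq_right h⟩
    · have hr0 : r ≠ [] := by
        rintro rfl
        exact absurd (targetWidth_pos hr hne) (not_lt.2 h)
      obtain ⟨s, h1, h2, h3⟩ := ih (fun q hq => hr q (List.mem_cons_of_mem _ hq)) hr0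
      exact ⟨s, h1.trans (List.suffix_cons p r), h2, (max_eq_left h).trans h3⟩

/-- The shelves opened after a history `s` are filled with respect to its capacity. -/
lemma number_le_of_suffix {s : List Piece} (hr : ∀ p ∈ r, 1 ≤ shortEdge p) (hs : s <:+ r)
    (hne : s ≠ []) (j : ℕ) :
    (4 : ℝ) ^ (j + 1) * (shelves r).number j ≤ 4 ^ (j + 1) * (shelves s).number j +
      (4 ^ (j + 1) + 8 * (4 ^ j * classLength j r) / targetWidth s) := by
  have hW := targetWidth_pos (fun p hp => hr p (hs.subset hp)) hne
  induction r with
  | nil => exact absurd (List.suffix_nil.1 hs) hne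
  | cons p r ih =>
    have hpos : ∀ q ∈ p :: r, 0 < longEdge q := fun q hq =>
      (zero_lt_one.trans_le (hr q hq)).trans_le (shortEdge_le_longEdge q)
    have hQ := classLength_nonneg (fun q hq => (hpos q hq).le) j
    rcases List.suffix_cons_iff.1 hs with rfl | h
    · have : 0 ≤ 8 * (4 ^ j * classLength j (p :: r)) / targetWidth (p :: r) := by positivity
      have : (0 : ℝ) < 4 ^ (j + 1) := by positivity
      linarith
    rcases number_cons hpos j with h' | h'
    · rw [h']
      refine (ih (fun q hq => hr q (List.mem_cons_of_mem _ hq)) h).trans ?_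
      have := classLength_le_cons (hpos p (by simp)).le r j
      gcongr
    · have h1 := targetWidth_le_capacity_of_suffix hs hne
      have h2 : 8 * (4 ^ j * classLength j (p :: r)) / capacity (p :: r) ≤
          8 * (4 ^ j * classLength j (p :: r)) / targetWidth s := by gcongr
      have h3 : 0 ≤ (4 : ℝ) ^ (j + 1) * (shelves s).number j := by positivity
      linarith

lemma height_le_of_suffix {s : List Piece} (hr : ∀ p ∈ r, 1 ≤ shortEdge p) (hs : s <:+ r)
    (hne : s ≠ []) :
    (shelves r).base (shelves r).count ≤ (shelves s).base (shelves s).count +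
      (6 * maxShort r + 8 * totalArea r / targetWidth s) := by
  have hr0 : r ≠ [] := fun h => hne (List.suffix_nil.1 (h ▸ hs))
  have hs1 : ∀ p ∈ s, 1 ≤ shortEdge p := fun p hp => hr p (hs.subset hp)
  have hW := targetWidth_pos hs1 hne
  obtain ⟨K, hK, hK4⟩ := exists_class_bound hr hr0
  obtain ⟨K', hK', -⟩ := exists_class_bound hs1 hne
  have hbase : ∑ j ∈ Finset.range K, (4 : ℝ) ^ (j + 1) * (shelves s).number j ≤
      (shelves s).base (shelves s).count := by
    rw [base_count_eq (K := max K K') _ fun j hj => hK' j ((le_max_right _ _).trans hj)]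
    exact Finset.sum_le_sum_of_subset_of_nonneg (Finset.range_mono (le_max_left _ _))
      fun _ _ _ => by positivity
  have h4 : ∑ j ∈ Finset.range K, (4 : ℝ) ^ (j + 1) ≤ 6 * maxShort r := by
    simp only [pow_succ]
    rw [← Finset.sum_mul, geom_sum_eq (by norm_num)]
    linarith [one_le_maxShort hr hr0]
  have h8 : ∑ j ∈ Finset.range K, 8 * (4 ^ j * classLength j r) / targetWidth s ≤
      8 * totalArea r / targetWidth s := by
    rw [← Finset.sum_div, ← Finset.mul_sum]
    gcongr
    exact sum_classLength_le hr _
  rw [base_count_eq _ hK]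
  refine (Finset.sum_le_sum fun j _ => number_le_of_suffix hr hs hne j).trans ?_
  rw [Finset.sum_add_distrib, Finset.sum_add_distrib]
  linarith

lemma maxShort_mono {s : List Piece} (hs : s <:+ r) : maxShort s ≤ maxShort r := by
  by_cases h : maxShort s = 0
  · exact h ▸ maxShort_nonneg r
  · obtain ⟨p, hp, e⟩ := exists_shortEdge_eq h
    exact e ▸ shortEdge_le_maxShort (hs.subset hp)

lemma maxLong_mono {s : List Piece} (hs : s <:+ r) : maxLong s ≤ maxLong r := by
  by_cases h : maxLong s = 0
  · exact h ▸ maxLong_nonneg r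
  · obtain ⟨p, hp, e⟩ := exists_longEdge_eq h
    exact e ▸ longEdge_le_maxLong (hs.subset hp)

/-- The area of the shelves, with any upper bound `B` for the two trivial lower bounds on the
optimum. -/
lemma capacity_mul_height_le (hr : ∀ p ∈ r, 1 ≤ shortEdge p) (hne : r ≠ []) {B : ℝ}
    (hA : totalArea r ≤ B) (hM : maxLong r * maxShort r ≤ B) :
    capacity r * (shelves r).base (shelves r).count ≤ 68 * (ratio r * B) := by
  obtain ⟨s, hs, hs0, hcap⟩ := exists_targetWidth_eq_capacity hr hne
  have hs1 : ∀ p ∈ s, 1 ≤ shortEdge p := fun p hp => hr p (hs.subset hp)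
  have hW := targetWidth_pos hs1 hs0
  have hρs := one_le_ratio hs1 hs0
  have hρ := ratio_mono hr hs
  have hms := one_le_maxShort hs1 hs0
  have hm := maxShort_mono hs
  have hMs := maxLong_mono hs
  have hAs := totalArea_mono hr hs
  have hMpos := maxLong_pos hs1 hs0
  have hB : 0 ≤ B := (totalArea_nonneg hr).trans hA
  have hm0 : 0 ≤ maxShort r := maxShort_nonneg r
  have hMm : maxLong s * maxShort r ≤ B := (by gcongr : _ ≤ _).trans hM
  have hMs' : maxLong s * maxShort s ≤ B := (by gcongr : _ ≤ _).trans hMm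
  have h1 : targetWidth s * maxShort s ≤ 2 * B := by
    have : targetWidth s ≤ max (2 * maxLong s) (totalArea s / maxShort s) :=
      max_le_max le_rfl (min_le_left _ _)
    rcases le_max_iff.1 this with h | h
    · nlinarith
    · rw [le_div_iff₀ (by linarith)] at h
      linarith
  have h2 : targetWidth s * maxShort r ≤ 2 * (ratio r * B) := by
    have h3 : targetWidth s ≤ max (2 * maxLong s) (ratio s * max (maxLong s) √(totalArea s)) :=
      max_le_max le_rfl (min_le_right _ _)
    have h4 : √(totalArea s) * maxShort r ≤ B := by
      have : √(totalArea s) * maxShort r ≤ √(totalArea r) * √(totalArea r) := by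
        gcongr
        exact Real.le_sqrt_of_sq_le (maxShort_sq_le hr)
      rw [Real.mul_self_sqrt (totalArea_nonneg hr)] at this
      linarith
    have h5 : max (maxLong s) √(totalArea s) * maxShort r ≤ B := by
      rw [max_mul_of_nonneg _ _ (by linarith)]
      exact max_le hMm h4
    have h7 : 0 ≤ max (maxLong s) √(totalArea s) * maxShort r :=
      mul_nonneg (hMpos.le.trans (le_max_left _ _)) hm0
    have h6 : B ≤ ratio r * B := le_mul_of_one_le_left hB (hρs.trans hρ)
    rcases le_max_iff.1 h3 with h | h
    · nlinarith
    · calc targetWidth s * maxShort r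
          ≤ ratio s * max (maxLong s) √(totalArea s) * maxShort r := by gcongr
        _ = ratio s * (max (maxLong s) √(totalArea s) * maxShort r) := by ring
        _ ≤ ratio r * B := mul_le_mul hρ h5 h7 (by linarith)
        _ ≤ _ := by linarith [mul_nonneg (by linarith : 0 ≤ ratio r) hB]
  have h3 := height_le hs1 hs0
  have h4 := height_le_of_suffix hr hs hs0
  have h5 : (shelves r).base (shelves r).count ≤ 24 * (maxShort s * ratio r) +
      (6 * maxShort r + 8 * totalArea r / targetWidth s) := by
    have : maxShort s * ratio s ≤ maxShort s * ratio r := by gcongr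
    linarith
  rw [hcap]
  calc _ ≤ targetWidth s * (24 * (maxShort s * ratio r) +
        (6 * maxShort r + 8 * totalArea r / targetWidth s)) := by gcongr
    _ = 24 * (ratio r * (targetWidth s * maxShort s)) + 6 * (targetWidth s * maxShort r) +
        8 * totalArea r := by field_simp; ring
    _ ≤ 24 * (ratio r * (2 * B)) + 6 * (2 * (ratio r * B)) + 8 * (ratio r * B) := by
        have : B ≤ ratio r * B := le_mul_of_one_le_left hB (hρs.trans hρ)
        gcongr
        · linarith
        · linarith
    _ = _ := by ring

end LongEdges
/-! ### The cost of a packing -/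

section Cost

open MeasureTheory

variable {L : List Piece} {pos : Fin L.length → ℝ × ℝ} {rot : Fin L.length → Bool}

lemma isCompact_packedRotSet (L : List Piece) (pos : Fin L.length → ℝ × ℝ)
    (rot : Fin L.length → Bool) : IsCompact (packedRotSet L pos rot) :=
  isCompact_iUnion fun _ => isCompact_Icc.prod isCompact_Icc

lemma packedRotSet_subset_box (L : List Piece) (pos : Fin L.length → ℝ × ℝ)
    (rot : Fin L.length → Bool) :
    packedRotSet L pos rot ⊆
      Icc (sInf (Prod.fst '' packedRotSet L pos rot)) (sSup (Prod.fst '' packedRotSet L pos rot)) ×ˢ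
      Icc (sInf (Prod.snd '' packedRotSet L pos rot))
        (sSup (Prod.snd '' packedRotSet L pos rot)) := by
  have h1 := (isCompact_packedRotSet L pos rot).image continuous_fst
  have h2 := (isCompact_packedRotSet L pos rot).image continuous_snd
  intro z hz
  exact ⟨⟨csInf_le h1.bddBelow ⟨z, hz, rfl⟩, le_csSup h1.bddAbove ⟨z, hz, rfl⟩⟩,
    ⟨csInf_le h2.bddBelow ⟨z, hz, rfl⟩, le_csSup h2.bddAbove ⟨z, hz, rfl⟩⟩⟩

lemma orient_le_box (hL : ∀ p ∈ L, PiecePos p) (i : Fin L.length) :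
    (orient (L.get i) (rot i)).1 ≤ boxWidth (packedRotSet L pos rot) ∧
      (orient (L.get i) (rot i)).2 ≤ boxHeight (packedRotSet L pos rot) := by
  have hp := hL (L.get i) (List.get_mem L i)
  have ho : 0 < (orient (L.get i) (rot i)).1 ∧ 0 < (orient (L.get i) (rot i)).2 := by
    unfold orient
    split_ifs
    exacts [⟨hp.2, hp.1⟩, hp]
  have h1 : pos i ∈ packedRotSet L pos rot :=
    mem_iUnion.2 ⟨i, ⟨⟨le_rfl, by linarith⟩, ⟨le_rfl, by linarith⟩⟩⟩
  have h2 : pos i + orient (L.get i) (rot i) ∈ packedRotSet L pos rot :=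
    mem_iUnion.2 ⟨i, ⟨⟨by simpa using ho.1.le, le_rfl⟩, ⟨by simpa using ho.2.le, le_rfl⟩⟩⟩
  have h3 := packedRotSet_subset_box L pos rot h1
  have h4 := packedRotSet_subset_box L pos rot h2
  have h5 := h4.1.2
  have h6 := h4.2.2
  rw [Prod.fst_add] at h5
  rw [Prod.snd_add] at h6
  exact ⟨by unfold boxWidth; linarith [h3.1.1], by unfold boxHeight; linarith [h3.2.1]⟩

lemma edges_le_box (hL : ∀ p ∈ L, PiecePos p) {p : Piece} (hp : p ∈ L) :
    shortEdge p ≤ boxWidth (packedRotSet L pos rot) ∧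
      shortEdge p ≤ boxHeight (packedRotSet L pos rot) ∧
      (longEdge p ≤ boxWidth (packedRotSet L pos rot) ∨
        longEdge p ≤ boxHeight (packedRotSet L pos rot)) := by
  obtain ⟨i, rfl⟩ := List.get_of_mem hp
  obtain ⟨h1, h2⟩ := orient_le_box (pos := pos) (rot := rot) hL i
  unfold orient at h1 h2
  unfold shortEdge longEdge
  split_ifs at h1 h2
  · refine ⟨min_le_of_right_le h1, min_le_of_left_le h2, ?_⟩
    rcases max_cases (L.get i).1 (L.get i).2 with ⟨e, -⟩ | ⟨e, -⟩ <;> rw [e]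
    exacts [Or.inr h2, Or.inl h1]
  · refine ⟨min_le_of_left_le h1, min_le_of_right_le h2, ?_⟩
    rcases max_cases (L.get i).1 (L.get i).2 with ⟨e, -⟩ | ⟨e, -⟩ <;> rw [e]
    exacts [Or.inl h1, Or.inr h2]

lemma long_mul_short_le_areaRotCost (hL : ∀ p ∈ L, PiecePos p) {p q : Piece} (hp : p ∈ L)
    (hq : q ∈ L) : longEdge p * shortEdge q ≤ areaRotCost L pos rot := by
  obtain ⟨-, -, h⟩ := edges_le_box (pos := pos) (rot := rot) hL hp
  obtain ⟨h1, h2, -⟩ := edges_le_box (pos := pos) (rot := rot) hL hq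
  have hq0 : 0 < shortEdge q := lt_min (hL q hq).1 (hL q hq).2
  have hp0 := longEdge_nonneg (hL p hp)
  unfold areaRotCost
  rcases h with h | h
  · exact mul_le_mul h h2 hq0.le (hp0.trans h)
  · rw [mul_comm]
    exact mul_le_mul h1 h hp0 (hq0.le.trans h1)

lemma volume_interior_placedRect (p : Piece) (hp : PiecePos p) (b : Bool) (z : ℝ × ℝ) :
    volume (interior (placedRect (orient p b) z)) =
      ENNReal.ofReal (longEdge p * shortEdge p) := by
  rw [interior_placedRect, Measure.volume_eq_prod, Measure.prod_prod, Real.volume_Ioo,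
    Real.volume_Ioo, add_sub_cancel_left, add_sub_cancel_left, longEdge, shortEdge, max_mul_min]
  unfold orient
  split_ifs
  · rw [mul_comm p.1, ENNReal.ofReal_mul hp.2.le]
  · rw [ENNReal.ofReal_mul hp.1.le]

/-- The total area of the pieces is a lower bound for the cost. -/
lemma totalArea_le_areaRotCost (hL : ∀ p ∈ L, PiecePos p) (h : IsRotPacking L pos rot) :
    totalArea L ≤ areaRotCost L pos rot := by
  rcases eq_or_ne L [] with rfl | hne
  · simp [totalArea, areaRotCost, packedRotSet, boxWidth]
  obtain ⟨p, hp⟩ := List.exists_mem_of_ne_nil L hne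
  have hbox := edges_le_box (pos := pos) (rot := rot) hL hp
  have hp0 : 0 < shortEdge p := lt_min (hL p hp).1 (hL p hp).2
  have hcost : 0 ≤ areaRotCost L pos rot :=
    mul_nonneg (hp0.le.trans hbox.1) (hp0.le.trans hbox.2.1)
  have hsum : totalArea L = ∑ i : Fin L.length, longEdge (L.get i) * shortEdge (L.get i) := by
    rw [totalArea, ← List.sum_ofFn]
    congr 1
    exact List.ext_get (by simp) (by simp)
  have hterm : ∀ i : Fin L.length, 0 ≤ longEdge (L.get i) * shortEdge (L.get i) := fun i => by
    have := hL _ (List.get_mem L i)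
    exact mul_nonneg (longEdge_nonneg this) (lt_min this.1 this.2).le
  rw [← ENNReal.ofReal_le_ofReal_iff hcost, hsum,
    ENNReal.ofReal_sum_of_nonneg fun i _ => hterm i]
  calc ∑ i : Fin L.length, ENNReal.ofReal (longEdge (L.get i) * shortEdge (L.get i))
      = ∑ i : Fin L.length,
          volume (interior (placedRect (orient (L.get i) (rot i)) (pos i))) :=
        Finset.sum_congr rfl fun i _ =>
          (volume_interior_placedRect _ (hL _ (List.get_mem L i)) _ _).symm
    _ = volume (⋃ i : Fin L.length,
          interior (placedRect (orient (L.get i) (rot i)) (pos i))) := by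
        rw [measure_iUnion (fun i j hij => h i j hij) fun i => isOpen_interior.measurableSet,
          tsum_fintype]
    _ ≤ volume (packedRotSet L pos rot) :=
        measure_mono (iUnion_mono fun i => interior_subset)
    _ ≤ _ := measure_mono (packedRotSet_subset_box L pos rot)
    _ = ENNReal.ofReal (areaRotCost L pos rot) := by
        rw [Measure.volume_eq_prod, Measure.prod_prod, Real.volume_Icc, Real.volume_Icc,
          areaRotCost, ENNReal.ofReal_mul (hp0.le.trans hbox.1), boxWidth, boxHeight]

lemma areaRotCost_le (hne : L ≠ []) {V H : ℝ} (hV : 0 ≤ V)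
    (hL : ∀ p ∈ L, PiecePos p) (h : packedRotSet L pos rot ⊆ Icc 0 V ×ˢ Icc 0 H) :
    areaRotCost L pos rot ≤ V * H := by
  obtain ⟨p, hp⟩ := List.exists_mem_of_ne_nil L hne
  have hbox := edges_le_box (pos := pos) (rot := rot) hL hp
  have hp0 : 0 < shortEdge p := lt_min (hL p hp).1 (hL p hp).2
  have hnon : (packedRotSet L pos rot).Nonempty := by
    by_contra h0
    rw [not_nonempty_iff_eq_empty] at h0
    have h1 := hbox.1
    rw [h0, boxWidth] at h1
    simp at h1
    linarith
  have key : ∀ (f : ℝ × ℝ → ℝ) (b : ℝ), (∀ z ∈ packedRotSet L pos rot, f z ∈ Icc 0 b) →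
      sSup (f '' packedRotSet L pos rot) - sInf (f '' packedRotSet L pos rot) ≤ b := by
    intro f b hf
    have h1 : sSup (f '' packedRotSet L pos rot) ≤ b :=
      csSup_le (hnon.image f) (by rintro _ ⟨z, hz, rfl⟩; exact (hf z hz).2)
    have h2 : 0 ≤ sInf (f '' packedRotSet L pos rot) :=
      le_csInf (hnon.image f) (by rintro _ ⟨z, hz, rfl⟩; exact (hf z hz).1)
    linarith
  exact mul_le_mul (key _ _ fun z hz => (h hz).1) (key _ _ fun z hz => (h hz).2)
    (hp0.le.trans hbox.2.1) hV

end Cost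

lemma totalArea_reverse (L : List Piece) : totalArea L.reverse = totalArea L := by
  simp [totalArea, List.sum_reverse]

lemma le_optRotArea {L : List Piece} (hL : ∀ p ∈ L, PiecePos p) {b : ℝ}
    (h : ∀ pos rot, IsRotPacking L pos rot → b ≤ areaRotCost L pos rot) : b ≤ optRotArea L := by
  refine le_csInf ⟨_, _, _, shelfStrategy_valid L hL, rfl⟩ ?_
  rintro _ ⟨pos, rot, hp, rfl⟩
  exact h pos rot hp

/-- The shelves contain all the pieces. -/
lemma algRotArea_shelfStrategy_le {L : List Piece} (hL : ∀ p ∈ L, PiecePos p) (hne : L ≠ []) :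
    algRotArea shelfStrategy L ≤
      capacity L.reverse * (shelves L.reverse).base (shelves L.reverse).count := by
  refine areaRotCost_le hne (capacity_nonneg _) hL ?_
  refine iUnion_subset fun i => ?_
  simp only [onlineRot, onlineRotPos, shelfStrategy_take i.2, List.get_eq_getElem, orient_turn]
  have hle : ∀ q ∈ L.reverse, 0 ≤ longEdge q :=
    fun q hq => longEdge_nonneg (hL q (List.mem_reverse.1 hq))
  have hle' : ∀ q ∈ (L.take i).reverse, 0 ≤ longEdge q := fun q hq =>
    longEdge_nonneg (hL q (List.mem_of_mem_take (List.mem_reverse.1 hq)))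
  obtain ⟨h1, h2, h3, h4⟩ := newest_mem_shelf hle
    (by simpa using cons_reverse_take_suffix i.2 i.2 : L[i] :: (L.take i).reverse <:+ L.reverse)
  have h5 := shelves_used_le L.reverse (newestShelf (L[i] :: (L.take i).reverse))
  have h6 := (shelves L.reverse).base_mono (Nat.succ_le_of_lt h1)
  rw [Nat.succ_eq_add_one, Shelves.base_succ, h2] at h6
  have h7 := shortEdge_lt_pow L[i]
  have h8 : 0 ≤ (newestPoint (L[i] :: (L.take i).reverse)).1 := shelves_used_nonneg hle' _
  have h9 : 0 ≤ (newestPoint (L[i] :: (L.take i).reverse)).2 := Shelves.base_nonneg _ _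
  rintro ⟨x, y⟩ ⟨⟨hx1, hx2⟩, hy1, hy2⟩
  simp only [Fin.getElem_fin] at *
  exact ⟨⟨by linarith, by linarith⟩, ⟨by linarith, by linarith⟩⟩

/-- There exist a constant `C > 0` and a valid online rotation
strategy `σ` such that for every nonempty finite stream `L` of `n` pieces,
all of whose edge lengths are at least 1,
`ALG_σ(L) ≤ C * min (√n) (OPT(L)^(1/4)) * OPT(L)` (area of the bounding box,
rotations by 90° allowed). -/
theorem area_rotation_simultaneous_upper_bound :
    ∃ C : ℝ, 0 < C ∧ ∃ σ : List Piece → (ℝ × ℝ) × Bool, RotStrategyValid σ ∧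
      ∀ L : List Piece, L ≠ [] → (∀ q ∈ L, 1 ≤ q.1 ∧ 1 ≤ q.2) →
        algRotArea σ L ≤
          C * min (Real.sqrt (L.length)) (optRotArea L ^ ((1 : ℝ) / 4)) *
            optRotArea L := by
  refine ⟨68, by norm_num, shelfStrategy, shelfStrategy_valid, fun L hne hL => ?_⟩
  have hpos : ∀ p ∈ L, PiecePos p := fun p hp =>
    ⟨zero_lt_one.trans_le (hL p hp).1, zero_lt_one.trans_le (hL p hp).2⟩
  have hr : ∀ p ∈ L.reverse, 1 ≤ shortEdge p := fun p hp =>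
    le_min (hL p (List.mem_reverse.1 hp)).1 (hL p (List.mem_reverse.1 hp)).2
  have hr0 : L.reverse ≠ [] := by simpa using hne
  have hA : totalArea L.reverse ≤ optRotArea L := by
    rw [totalArea_reverse]
    exact le_optRotArea hpos fun pos rot h => totalArea_le_areaRotCost hpos h
  have hM : maxLong L.reverse * maxShort L.reverse ≤ optRotArea L := by
    obtain ⟨p, hp, ep⟩ := exists_longEdge_eq (maxLong_pos hr hr0).ne'
    obtain ⟨q, hq, eq⟩ :=
      exists_shortEdge_eq (zero_lt_one.trans_le (one_le_maxShort hr hr0)).ne'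
    rw [← ep, ← eq]
    exact le_optRotArea hpos fun pos rot _ =>
      long_mul_short_le_areaRotCost hpos (List.mem_reverse.1 hp) (List.mem_reverse.1 hq)
  have hO : 0 ≤ optRotArea L := (totalArea_nonneg hr).trans hA
  have hroot : √√(totalArea L.reverse) ≤ optRotArea L ^ ((1 : ℝ) / 4) := by
    rw [Real.sqrt_eq_rpow, Real.sqrt_eq_rpow, ← Real.rpow_mul (totalArea_nonneg hr)]
    norm_num
    exact Real.rpow_le_rpow (totalArea_nonneg hr) hA (by norm_num)
  have hρ : ratio L.reverse ≤ min √(L.length : ℝ) (optRotArea L ^ ((1 : ℝ) / 4)) :=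
    min_le_min (by rw [List.length_reverse]) hroot
  refine (algRotArea_shelfStrategy_le hpos hne).trans
    ((capacity_mul_height_le hr hr0 hA hM).trans ?_)
  rw [mul_assoc]
  gcongr
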